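/- arXiv:2304.12597 — 2 statements merged into one kernel-verified Lean document; each statement's English description precedes it below -/
import Mathlib

section
/- Let K ∈ ℝ^{n̄×n̄} be symmetric positive definite, τ > 0, and J_ℓ = I_{n̄} + Σ_{i=1}^ℓ γ_i·((1−π_i)·I_{n̄} + τ·K)^{−1} (which is Hermitian positive definite, hence invertible). Then the spectral condition number of J_ℓ satisfies κ(J_ℓ) := ‖J_ℓ‖₂·‖J_ℓ^{−1}‖₂ ≤ 1 + 1/(τ·λ_min(K)), where λ_min(K) denotes the smallest eigenvalue of K and ‖·‖₂ is the operator 2-norm. -/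
open Matrix
lemma key_sum (ℓ : ℕ) (hℓ : 1 ≤ ℓ) (ω : ℂ) (hω : IsPrimitiveRoot ω ℓ) (μ : ℝ) (hμ : 1 < μ) :
    1 + ∑ i : Fin ℓ, (ω ^ (i:ℕ) / ℓ) * ((1 - ω ^ (i:ℕ)) + ((μ - 1 : ℝ) : ℂ))⁻¹
      = (((1 - (μ ^ ℓ)⁻¹)⁻¹ : ℝ) : ℂ) := by
  have hl0 : (ℓ : ℂ) ≠ 0 := by exact_mod_cast (by omega : ℓ ≠ 0)
  have h1 : 1 < μ ^ ℓ := one_lt_pow₀ hμ (by omega)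
  have hz : ((μ : ℂ) ^ ℓ - 1) ≠ 0 := by
    have : μ ^ ℓ - 1 ≠ 0 := by linarith
    exact_mod_cast this
  have hz' : ((μ : ℂ) ^ ℓ) ≠ 0 := by
    have : μ ^ ℓ ≠ 0 := by linarith
    exact_mod_cast this
  have hpow : ∀ i : ℕ, (ω ^ i) ^ ℓ = 1 := fun i => by
    rw [← pow_mul, mul_comm, pow_mul, hω.pow_eq_one, one_pow]
  have hterm : ∀ i : ℕ, (ω ^ i / ℓ) * ((1 - ω ^ i) + ((μ - 1 : ℝ) : ℂ))⁻¹
      = ((μ : ℂ) ^ ℓ - 1)⁻¹ * (ℓ : ℂ)⁻¹ *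
        ∑ k ∈ Finset.range ℓ, (μ : ℂ) ^ k * (ω ^ (ℓ - k)) ^ i := by
    intro i
    have hg := (Commute.all (μ : ℂ) (ω ^ i)).geom_sum₂_mul ℓ
    rw [hpow] at hg
    have hne : (μ : ℂ) - ω ^ i ≠ 0 := by
      intro h; rw [h, mul_zero] at hg; exact hz hg.symm
    have hs : ∑ k ∈ Finset.range ℓ, (μ : ℂ) ^ k * (ω ^ (ℓ - k)) ^ i
        = ω ^ i * ∑ k ∈ Finset.range ℓ, (μ : ℂ) ^ k * (ω ^ i) ^ (ℓ - 1 - k) := by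
      rw [Finset.mul_sum]
      refine Finset.sum_congr rfl fun k hk => ?_
      have hk' := Finset.mem_range.1 hk
      have : ℓ - k = (ℓ - 1 - k) + 1 := by omega
      rw [this, ← pow_mul, ← pow_mul]; ring
    rw [hs]
    have : (1 - ω ^ i) + ((μ - 1 : ℝ) : ℂ) = (μ : ℂ) - ω ^ i := by push_cast; ring
    rw [this]
    field_simp
    rw [← hg]; ring
  rw [Fin.sum_univ_eq_sum_range (fun i => (ω ^ i / ℓ) * ((1 - ω ^ i) + ((μ - 1 : ℝ) : ℂ))⁻¹) ℓ]
  rw [Finset.sum_congr rfl (fun i _ => hterm i), ← Finset.mul_sum, Finset.sum_comm]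
  have hin : ∑ k ∈ Finset.range ℓ, ∑ i ∈ Finset.range ℓ, (μ : ℂ) ^ k * (ω ^ (ℓ - k)) ^ i = ℓ := by
    rw [Finset.sum_eq_single_of_mem 0 (by simp; omega)]
    · simp [hω.pow_eq_one]
    · intro k hk hk0
      have hk' := Finset.mem_range.1 hk
      rw [← Finset.mul_sum]
      have hne : ω ^ (ℓ - k) ≠ 1 := hω.pow_ne_one_of_pos_of_lt (by omega) (by omega)
      have := mul_geom_sum (ω ^ (ℓ - k)) ℓ
      rw [hpow, sub_self] at this
      rw [(mul_eq_zero.1 this).resolve_left (sub_ne_zero.2 hne), mul_zero]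
  rw [hin]
  push_cast
  have : (1 - ((μ : ℂ) ^ ℓ)⁻¹) = ((μ : ℂ) ^ ℓ - 1) / (μ : ℂ) ^ ℓ := by field_simp
  rw [this]
  field_simp
  ring

open scoped Matrix.Norms.L2Operator in
lemma norm_conj_diag {n : ℕ} (U : Matrix (Fin n) (Fin n) ℂ)
    (hU : U ∈ unitary (Matrix (Fin n) (Fin n) ℂ)) (d : Fin n → ℂ) (c : ℝ) (hc : 0 ≤ c)
    (h : ∀ i, ‖d i‖ ≤ c) :
    ‖Matrix.toEuclideanCLM (𝕜 := ℂ) (U * diagonal d * star U)‖ ≤ c := by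
  rw [← Matrix.cstar_norm_def]
  have h1 := CStarRing.norm_mul_coe_unitary (U * diagonal d) (star (⟨U, hU⟩ : unitary _))
  have h2 := CStarRing.norm_coe_unitary_mul (⟨U, hU⟩ : unitary _) (diagonal d)
  simp only [Unitary.coe_star] at h1 h2
  rw [h1, h2, Matrix.l2_opNorm_diagonal]
  exact (pi_norm_le_iff_of_nonneg hc).2 h

lemma inv_conj {n : ℕ} (U : Matrix (Fin n) (Fin n) ℂ)
    (hU : U ∈ unitary (Matrix (Fin n) (Fin n) ℂ)) (d : Fin n → ℂ) (h : ∀ i, d i ≠ 0) :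
    (U * diagonal d * star U)⁻¹ = U * diagonal (fun i => (d i)⁻¹) * star U := by
  apply Matrix.inv_eq_right_inv
  have h1 := (Unitary.mem_iff.1 hU).1
  have h2 := (Unitary.mem_iff.1 hU).2
  calc _ = U * diagonal d * (star U * U) * diagonal (fun i => (d i)⁻¹) * star U := by
        simp only [Matrix.mul_assoc]
    _ = 1 := by
        rw [h1, Matrix.mul_one, Matrix.mul_assoc U, diagonal_mul_diagonal]
        simp [h, h2]

theorem paradiag_Jl_condition_number_bound
    (nbar ℓ : ℕ) (hn : 0 < nbar) (hℓ : 1 ≤ ℓ)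
    (K : Matrix (Fin nbar) (Fin nbar) ℝ) (hK : K.PosDef)
    (τ : ℝ) (hτ : 0 < τ)
    (ω : ℂ) (hω : ω = Complex.exp (-(2 * Real.pi * Complex.I) / ℓ))
    (π : Fin ℓ → ℂ) (hπ : ∀ i, π i = ω ^ (i : ℕ))
    (γ : Fin ℓ → ℂ) (hγ : ∀ i, γ i = π i / ℓ)
    (Kc : Matrix (Fin nbar) (Fin nbar) ℂ) (hKc : Kc = K.map Complex.ofReal)
    (A : Fin ℓ → Matrix (Fin nbar) (Fin nbar) ℂ)
    (hA : ∀ i, A i = (1 - π i) • (1 : Matrix (Fin nbar) (Fin nbar) ℂ) + (τ : ℂ) • Kc)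
    (J : Matrix (Fin nbar) (Fin nbar) ℂ)
    (hJ : J = 1 + ∑ i, γ i • (A i)⁻¹)
    (lminK : ℝ) (hlmin : lminK = ⨅ i, hK.1.eigenvalues i) :
    ‖Matrix.toEuclideanCLM (𝕜 := ℂ) J‖ * ‖Matrix.toEuclideanCLM (𝕜 := ℂ) J⁻¹‖ ≤
      1 + 1 / (τ * lminK) := by
  have hprim : IsPrimitiveRoot ω ℓ := by
    have h := (Complex.isPrimitiveRoot_exp ℓ (by omega)).inv
    rw [← Complex.exp_neg] at h
    rw [hω, neg_div]; exact h
  have : Nonempty (Fin nbar) := ⟨⟨0, hn⟩⟩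
  set ev := hK.1.eigenvalues with hev
  have hle : ∀ j, lminK ≤ ev j := fun j => by
    rw [hlmin]; exact ciInf_le (Set.finite_range _).bddBelow j
  have hlpos : 0 < lminK := by
    obtain ⟨j, hj⟩ := exists_eq_ciInf_of_finite (f := ev)
    rw [hlmin, ← hj]; exact hK.eigenvalues_pos j
  have hevpos : ∀ j, 0 < ev j := fun j => hK.eigenvalues_pos j
  -- complexified unitary
  let φ : Matrix (Fin nbar) (Fin nbar) ℝ →+* Matrix (Fin nbar) (Fin nbar) ℂ :=
    Complex.ofRealHom.mapMatrix
  have hφs : ∀ M, φ (star M) = star (φ M) := fun M => by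
    ext i j; simp [φ, Matrix.star_apply]
  let V := hK.1.eigenvectorUnitary
  let U := φ (V : Matrix (Fin nbar) (Fin nbar) ℝ)
  have hUU : U * star U = 1 := by
    simp only [U]; rw [← hφs, ← map_mul, (Unitary.mem_iff.1 V.2).2, map_one]
  have hUU' : star U * U = 1 := by
    simp only [U]; rw [← hφs, ← map_mul, (Unitary.mem_iff.1 V.2).1, map_one]
  have hU : U ∈ unitary (Matrix (Fin nbar) (Fin nbar) ℂ) := Unitary.mem_iff.2 ⟨hUU', hUU⟩
  have hKd : Kc = U * diagonal (fun j => (ev j : ℂ)) * star U := by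
    have h := hK.1.spectral_theorem
    rw [Unitary.conjStarAlgAut_apply] at h
    have h2 := congrArg φ h
    rw [map_mul, map_mul, hφs] at h2
    have h3 : φ K = Kc := by rw [hKc]; rfl
    rw [← h3, h2]
    congr 2
    ext i j
    by_cases hij : i = j <;> simp [φ, hij, hev]
  have hAd : ∀ i, A i = U * diagonal (fun j => (1 - ω ^ (i:ℕ)) + (((1 + τ * ev j) - 1 : ℝ) : ℂ)) * star U := by
    intro i
    have : diagonal (fun j => (1 - ω ^ (i:ℕ)) + (((1 + τ * ev j) - 1 : ℝ) : ℂ))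
      = (1 - ω ^ (i:ℕ)) • (1 : Matrix (Fin nbar) (Fin nbar) ℂ) + (τ : ℂ) • diagonal (fun j => (ev j : ℂ)) := by
      ext a b
      by_cases hab : a = b <;> simp [hab]
    rw [this, hA, hπ, hKd]
    simp only [Matrix.mul_add, Matrix.add_mul, Matrix.mul_smul, Matrix.smul_mul, Matrix.mul_one, hUU]
  have hmu : ∀ j, 1 < 1 + τ * ev j := fun j => by have := mul_pos hτ (hevpos j); linarith
  have hAi : ∀ i, (A i)⁻¹ = U * diagonal (fun j => ((1 - ω ^ (i:ℕ)) + (((1 + τ * ev j) - 1 : ℝ) : ℂ))⁻¹) * star U := by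
    intro i
    rw [hAd, inv_conj U hU]
    intro j h
    have h1 : ω ^ (i:ℕ) = ((1 + τ * ev j : ℝ) : ℂ) := by
      push_cast at h ⊢; linear_combination -h
    have h2 : ‖ω ^ (i:ℕ)‖ = 1 := by
      rw [norm_pow, hprim.norm'_eq_one (by omega), one_pow]
    rw [h1, Complex.norm_real, Real.norm_of_nonneg (by linarith [hmu j])] at h2
    linarith [hmu j]
  let g : Fin nbar → ℝ := fun j => (1 - ((1 + τ * ev j) ^ ℓ)⁻¹)⁻¹
  have hJd : J = U * diagonal (fun j => (g j : ℂ)) * star U := by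
    have : diagonal (fun j => (g j : ℂ)) = 1 + ∑ i : Fin ℓ, (ω ^ (i:ℕ) / ℓ) •
        diagonal (fun j => ((1 - ω ^ (i:ℕ)) + (((1 + τ * ev j) - 1 : ℝ) : ℂ))⁻¹) := by
      ext a b
      rw [Matrix.add_apply, Matrix.sum_apply]
      by_cases hab : a = b
      · subst hab
        simp only [Matrix.smul_apply, diagonal_apply_eq, Matrix.one_apply_eq, smul_eq_mul]
        exact (key_sum ℓ hℓ ω hprim _ (hmu a)).symm
      · simp [hab]
    rw [this, hJ, Matrix.mul_add, Matrix.add_mul, Matrix.mul_one, hUU, Finset.mul_sum, Finset.sum_mul]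
    congr 1
    refine Finset.sum_congr rfl fun i _ => ?_
    rw [hAi, hγ, hπ, Matrix.mul_smul, Matrix.smul_mul]
  have hpw : ∀ j, 1 + τ * ev j ≤ (1 + τ * ev j) ^ ℓ := fun j =>
    le_self_pow₀ (hmu j).le (by omega)
  have hinv : ∀ j, ((1 + τ * ev j) ^ ℓ)⁻¹ ≤ (1 + τ * lminK)⁻¹ := fun j => by
    have := mul_le_mul_of_nonneg_left (hle j) hτ.le
    have := mul_pos hτ hlpos
    exact inv_anti₀ (by linarith) (by linarith [hpw j])
  have ht := mul_pos hτ hlpos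
  have hlt : (1 + τ * lminK)⁻¹ < 1 := inv_lt_one_of_one_lt₀ (by linarith)
  have hipos : ∀ j, 0 < ((1 + τ * ev j) ^ ℓ)⁻¹ := fun j => by
    have := hmu j; positivity
  have hg1 : ∀ j, 0 < 1 - ((1 + τ * ev j) ^ ℓ)⁻¹ := fun j => by linarith [hinv j]
  have hc : 1 + 1 / (τ * lminK) = (1 - (1 + τ * lminK)⁻¹)⁻¹ := by
    have : 1 - (1 + τ * lminK)⁻¹ = (τ * lminK) / (1 + τ * lminK) := by
      field_simp; ring
    rw [this]; field_simp; ring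
  have hcpos : 0 ≤ 1 + 1 / (τ * lminK) := by positivity
  have hn1 : ‖Matrix.toEuclideanCLM (𝕜 := ℂ) J‖ ≤ 1 + 1 / (τ * lminK) := by
    rw [hJd]
    refine norm_conj_diag U hU _ _ hcpos fun j => ?_
    rw [Complex.norm_real, Real.norm_of_nonneg (inv_pos.2 (hg1 j)).le, hc]
    exact inv_anti₀ (by linarith) (by linarith [hinv j])
  have hn2 : ‖Matrix.toEuclideanCLM (𝕜 := ℂ) J⁻¹‖ ≤ 1 := by
    rw [hJd, inv_conj U hU]
    · refine norm_conj_diag U hU _ _ zero_le_one fun j => ?_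
      rw [← Complex.ofReal_inv, Complex.norm_real]
      simp only [g, inv_inv]
      rw [Real.norm_of_nonneg (hg1 j).le]
      linarith [hipos j]
    · intro j
      exact Complex.ofReal_ne_zero.2 (inv_pos.2 (hg1 j)).ne'
  calc _ ≤ (1 + 1 / (τ * lminK)) * 1 := mul_le_mul hn1 hn2 (norm_nonneg _) hcpos
    _ = _ := mul_one _
end

section
/- Let n ≥ 1, h = 1/(n+1), let T ∈ ℝ^{n×n} be the tridiagonal matrix (1/h²)·tridiag(−1, 2, −1) (i.e. T_{jj} = 2/h², T_{j,j+1} = T_{j+1,j} = −1/h², all other entries zero), and let K = I_n ⊗ T + T ⊗ I_n ∈ ℝ^{n²×n²} be the finite-difference discretization of the 2-dimensional Laplace operator. Then K is symmetric positive definite and its smallest eigenvalue is λ_min(K) = (8/h²)·sin²(π/(2(n+1))). -/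
open Matrix
open scoped Kronecker

lemma aux_perron {ι : Type*} [Fintype ι] [DecidableEq ι] (A : Matrix ι ι ℝ)
    (hoff : ∀ i j, i ≠ j → A i j ≤ 0) (w : ι → ℝ) (hw : ∀ i, 0 < w i) (l : ℝ)
    (hl : A *ᵥ w = l • w) (x : ι → ℝ) (t : ℝ) (hx : A *ᵥ x = t • x)
    (i0 : ι) (hpos : 0 < x i0) : l ≤ t := by
  obtain ⟨i, -, hi⟩ := Finset.exists_max_image Finset.univ (fun i => x i / w i) ⟨i0, Finset.mem_univ _⟩
  set c := x i / w i with hc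
  have hcpos : 0 < c := lt_of_lt_of_le (div_pos hpos (hw i0)) (hi i0 (Finset.mem_univ _))
  have hxi : x i = c * w i := by rw [hc]; field_simp [(hw i).ne']
  have hle : ∀ j, x j ≤ c * w j := fun j => (div_le_iff₀ (hw j)).1 (hi j (Finset.mem_univ _))
  have h1 : ∑ j, A i j * (c * w j) ≤ ∑ j, A i j * x j := by
    refine Finset.sum_le_sum fun j _ => ?_
    by_cases hij : i = j
    · subst hij; rw [hxi]
    · exact mul_le_mul_of_nonpos_left (hle j) (hoff i j hij)
  have h2 : ∑ j, A i j * x j = t * x i := by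
    simpa [mulVec, dotProduct] using congrFun hx i
  have h3 : ∑ j, A i j * w j = l * w i := by
    simpa [mulVec, dotProduct] using congrFun hl i
  have h4 : ∑ j, A i j * (c * w j) = c * (l * w i) := by
    rw [← h3, Finset.mul_sum]; exact Finset.sum_congr rfl fun j _ => by ring
  rw [h4, h2, hxi] at h1
  have : 0 < c * w i := mul_pos hcpos (hw i)
  nlinarith

lemma aux_perron' {ι : Type*} [Fintype ι] [DecidableEq ι] (A : Matrix ι ι ℝ)
    (hoff : ∀ i j, i ≠ j → A i j ≤ 0) (w : ι → ℝ) (hw : ∀ i, 0 < w i) (l : ℝ)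
    (hl : A *ᵥ w = l • w) (x : ι → ℝ) (t : ℝ) (hx : A *ᵥ x = t • x)
    (hx0 : x ≠ 0) : l ≤ t := by
  obtain ⟨i0, hi0⟩ := Function.ne_iff.1 hx0
  rcases lt_or_gt_of_ne hi0 with h | h
  · refine aux_perron A hoff w hw l hl (-x) t ?_ i0 (by simpa using h)
    rw [mulVec_neg, hx, smul_neg]
  · exact aux_perron A hoff w hw l hl x t hx i0 h

lemma aux_tri (n j : ℕ) (hj : j < n) (s : ℕ → ℝ) (h0 : s 0 = 0) (hn : s (n + 1) = 0) :
    ∑ k ∈ Finset.range n, (if j = k then (2:ℝ) else if j + 1 = k ∨ k + 1 = j then -1 else 0)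
      * s (k + 1) = 2 * s (j + 1) - s (j + 2) - s j := by
  have e : ∀ k ∈ Finset.range n,
      (if j = k then (2:ℝ) else if j + 1 = k ∨ k + 1 = j then -1 else 0) * s (k + 1)
      = (if j = k then 2 * s (k + 1) else 0) - (if j + 1 = k then s (k + 1) else 0)
        - (if k + 1 = j then s (k + 1) else 0) := by
    intro k _
    split_ifs <;> first | omega | ring
  rw [Finset.sum_congr rfl e, Finset.sum_sub_distrib, Finset.sum_sub_distrib,
    Finset.sum_ite_eq, Finset.sum_ite_eq]
  have e2 : (if j + 1 ∈ Finset.range n then s (j + 1 + 1) else 0) = s (j + 2) := by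
    split_ifs with hm
    · rfl
    · rw [Finset.mem_range] at hm
      have : j + 2 = n + 1 := by omega
      rw [this, hn]
  have e3 : ∑ k ∈ Finset.range n, (if k + 1 = j then s (k + 1) else 0) = s j := by
    cases j with
    | zero => simp [h0]
    | succ m =>
      simp only [Nat.add_right_cancel_iff, Finset.sum_ite_eq', Finset.mem_range]
      rw [if_pos (by omega)]
  rw [e2, e3, if_pos (Finset.mem_range.2 hj)]

/-- the 2D finite-difference Laplacian `K = I ⊗ T + T ⊗ I` is
symmetric positive definite with `λ_min(K) = (8/h²) sin²(π/(2(n+1)))`. -/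
theorem laplacian_2d_min_eigenvalue
    (n : ℕ) (hn : 1 ≤ n)
    (h : ℝ) (hh : h = 1 / (n + 1))
    (T : Matrix (Fin n) (Fin n) ℝ)
    (hT : ∀ j k : Fin n, T j k =
      if j = k then 2 / h ^ 2
      else if (j : ℕ) + 1 = (k : ℕ) ∨ (k : ℕ) + 1 = (j : ℕ) then -1 / h ^ 2
      else 0)
    (K : Matrix (Fin n × Fin n) (Fin n × Fin n) ℝ)
    (hK : K = (1 : Matrix (Fin n) (Fin n) ℝ) ⊗ₖ T + T ⊗ₖ (1 : Matrix (Fin n) (Fin n) ℝ)) :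
    ∃ hKpd : K.PosDef,
      (⨅ p, hKpd.1.eigenvalues p) = 8 / h ^ 2 * Real.sin (Real.pi / (2 * (n + 1))) ^ 2 := by
  have hn1 : (0:ℝ) < n + 1 := by positivity
  have hhpos : 0 < h := by rw [hh]; positivity
  set φ : ℝ := Real.pi / (2 * (n + 1)) with hφ
  have hφ2 : (n + 1) * (2 * φ) = Real.pi := by rw [hφ]; field_simp
  have hφpos : 0 < φ := by rw [hφ]; have := Real.pi_pos; positivity
  have hφlt : φ < Real.pi := by
    have : (1:ℝ) ≤ n := by exact_mod_cast hn
    nlinarith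
  have hsin : 0 < Real.sin φ := Real.sin_pos_of_pos_of_lt_pi hφpos hφlt
  set s : ℕ → ℝ := fun m => Real.sin (m * (2 * φ)) with hs
  have hs0 : s 0 = 0 := by simp [hs]
  have hsn : s (n + 1) = 0 := by simp only [hs]; push_cast; rw [hφ2, Real.sin_pi]
  have hspos : ∀ k : Fin n, 0 < s (k + 1) := by
    intro k
    have hk : ((k : ℕ) : ℝ) < n := by exact_mod_cast k.2
    refine Real.sin_pos_of_pos_of_lt_pi (by positivity) ?_
    rw [← hφ2]; push_cast
    exact mul_lt_mul_of_pos_right (by linarith) (by positivity)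
  have hrec : ∀ j : ℕ, 2 * s (j + 1) - s (j + 2) - s j = 4 * Real.sin φ ^ 2 * s (j + 1) := by
    intro j
    have a : s (j + 2) = Real.sin ((j + 1 : ℕ) * (2 * φ) + 2 * φ) := by
      simp only [hs]; push_cast; congr 1; ring
    have b : s j = Real.sin ((j + 1 : ℕ) * (2 * φ) - 2 * φ) := by
      simp only [hs]; push_cast; congr 1; ring
    rw [a, b, Real.sin_add, Real.sin_sub, Real.cos_two_mul, Real.cos_sq']
    simp only [hs]; ring
  have hTv : ∀ j : Fin n, ∑ k : Fin n, T j k * s (k + 1)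
      = 4 / h ^ 2 * Real.sin φ ^ 2 * s (j + 1) := by
    intro j
    have e := aux_tri n j j.2 s hs0 hsn
    rw [hrec, ← Fin.sum_univ_eq_sum_range (fun k => (if (j:ℕ) = k then (2:ℝ) else
      if (j:ℕ) + 1 = k ∨ k + 1 = (j:ℕ) then -1 else 0) * s (k + 1))] at e
    calc _ = (1 / h ^ 2) * ∑ k : Fin n, (if (j:ℕ) = k then (2:ℝ) else
      if (j:ℕ) + 1 = k ∨ (k:ℕ) + 1 = (j:ℕ) then -1 else 0) * s (k + 1) := by
          rw [Finset.mul_sum]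
          refine Finset.sum_congr rfl fun k _ => ?_
          rw [hT]; simp only [Fin.ext_iff]
          split_ifs <;> ring
      _ = _ := by rw [e]; ring
  have hTsymm : ∀ j k, T j k = T k j := by
    intro j k; rw [hT, hT]
    simp only [eq_comm (a := k) (b := j), or_comm]
  have hToff : ∀ j k, j ≠ k → T j k ≤ 0 := by
    intro j k hjk; rw [hT, if_neg hjk]
    split_ifs
    · rw [neg_div]; have : 0 < 1 / h ^ 2 := by positivity
      linarith
    · exact le_rfl
  have hKe : ∀ p q, K p q = (if p.1 = q.1 then T p.2 q.2 else 0)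
      + (if p.2 = q.2 then T p.1 q.1 else 0) := by
    intro p q
    rw [hK]; simp [Matrix.one_apply, kroneckerMap_apply]
  have hKH : K.IsHermitian := by
    ext p q
    simp only [conjTranspose_apply, star_trivial, hKe]
    rw [hTsymm q.2, hTsymm q.1]
    simp only [eq_comm (a := q.1), eq_comm (a := q.2)]
  have hKoff : ∀ p q, p ≠ q → K p q ≤ 0 := by
    rintro ⟨a, b⟩ ⟨c, d⟩ hpq
    rw [hKe]
    have h1 : ¬ (a = c ∧ b = d) := fun h => hpq (Prod.ext h.1 h.2)
    dsimp only
    split_ifs with h2 h3 h3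
    · exact absurd ⟨h2, h3⟩ h1
    · have := hToff b d h3; linarith
    · have := hToff a c h2; linarith
    · simp
  set w : Fin n × Fin n → ℝ := fun p => s (p.1 + 1) * s (p.2 + 1) with hw
  have hwpos : ∀ p, 0 < w p := fun p => mul_pos (hspos _) (hspos _)
  set l := 8 / h ^ 2 * Real.sin φ ^ 2 with hl
  have hlpos : 0 < l := by positivity
  have hKw : K *ᵥ w = l • w := by
    ext ⟨a, b⟩
    simp only [mulVec, dotProduct, hKe, Pi.smul_apply, smul_eq_mul, hw, add_mul,
      Finset.sum_add_distrib, Fintype.sum_prod_type, ite_mul, zero_mul]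
    have e1 : ∑ c : Fin n, ∑ d : Fin n, (if a = c then T b d * (s (c + 1) * s (d + 1)) else 0)
        = s (a + 1) * ∑ d, T b d * s (d + 1) := by
      rw [Finset.sum_comm, Finset.mul_sum]
      refine Finset.sum_congr rfl fun d _ => ?_
      rw [Finset.sum_ite_eq, if_pos (Finset.mem_univ _)]; ring
    have e2 : ∑ c : Fin n, ∑ d : Fin n, (if b = d then T a c * (s (c + 1) * s (d + 1)) else 0)
        = s (b + 1) * ∑ c, T a c * s (c + 1) := by
      rw [Finset.mul_sum]
      refine Finset.sum_congr rfl fun d _ => ?_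
      rw [Finset.sum_ite_eq, if_pos (Finset.mem_univ _)]; ring
    rw [e1, e2, hTv, hTv, hl]; ring
  have hge : ∀ p, l ≤ hKH.eigenvalues p := by
    intro p
    refine aux_perron' K hKoff w hwpos l hKw _ _ (hKH.mulVec_eigenvectorBasis p) ?_
    intro h0
    apply hKH.eigenvectorBasis.orthonormal.ne_zero p
    ext i; exact congrFun h0 i
  have hpd : K.PosDef := hKH.posDef_iff_eigenvalues_pos.2 fun p => lt_of_lt_of_le hlpos (hge p)
  refine ⟨hpd, ?_⟩
  let i0 : Fin n × Fin n := (⟨0, hn⟩, ⟨0, hn⟩)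
  haveI : Nonempty (Fin n × Fin n) := ⟨i0⟩
  have hmem : l ∈ spectrum ℝ K := by
    rw [← Matrix.spectrum_toLin', ← Module.End.hasEigenvalue_iff_mem_spectrum]
    refine Module.End.hasEigenvalue_of_hasEigenvector (x := w) ?_
    refine ⟨Module.End.mem_eigenspace_iff.2 (by rw [Matrix.toLin'_apply, hKw]), fun h0 => ?_⟩
    exact (hwpos i0).ne' (congrFun h0 i0)
  rw [hKH.spectrum_real_eq_range_eigenvalues] at hmem
  obtain ⟨p, hp⟩ := hmem
  refine le_antisymm ?_ (le_ciInf hge)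
  rw [← hp]
  exact ciInf_le (Set.finite_range _).bddBelow p
end
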